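/- (No finite weakly free model despite existence of a finite universal model.) There do not exist a finite type A, a function f_A : A → A having exactly one fixed point, and an element a ∈ A, such that for every type B, every function g : B → B having exactly one fixed point, and every element b ∈ B, there exists a function h : A → B with h ∘ f_A = g ∘ h and h a = b. -/

import Mathlib

theorem existsUnique_optionMap_succ_eq : ∃! x : Option ℕ, Option.map Nat.succ x = x := by
  refine ⟨none, rfl, ?_⟩
  rintro (_ | n) hn
  · rfl
  · simp at hn

theorem optionMap_succ_iterate (n : ℕ) : (Option.map Nat.succ)^[n] (some 0) = some n := by
  induction n with
  | zero => rfl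
  | succ n ih => rw [Function.iterate_succ_apply', ih]; rfl

/-- No finite weakly free model despite existence of a finite universal model. -/
theorem stmt_14 :
    ¬ ∃ (A : Type) (_ : Finite A) (f : A → A) (_ : ∃! x : A, f x = x) (a : A),
        ∀ (B : Type) (g : B → B), (∃! x : B, g x = x) → ∀ b : B,
          ∃ h : A → B, h ∘ f = g ∘ h ∧ h a = b := by
  rintro ⟨A, _, f, _, a, hfree⟩
  obtain ⟨h, hcomm, ha⟩ := hfree _ _ existsUnique_optionMap_succ_eq (some 0)
  have hsemi : Function.Semiconj h f (Option.map Nat.succ) := congrFun hcomm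
  have horbit (n : ℕ) : h (f^[n] a) = some n := by
    rw [(hsemi.iterate_right n).eq, ha, optionMap_succ_iterate]
  refine not_injective_infinite_finite (fun n : ℕ => f^[n] a) fun m n hmn => ?_
  exact Option.some_injective _ (by rw [← horbit m, ← horbit n]; exact congrArg h hmn)
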